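/- arXiv:1706.03180 — 4 statements merged into one kernel-verified Lean document; each statement's English description precedes it below -/
import Mathlib

section
/- Let H ≠ {1} be a reduced atomic unit-cancellative monoid which is finitely presented and has accepted elasticity, i.e. there exists L ∈ 𝓛(H) with ρ(L) = ρ(H) < ∞. Then there is a bound M ∈ ℕ such that ρ_k(H) − ρ_{k−1}(H) ≤ M for all k ≥ 2, and 𝓛(H) satisfies the Structure Theorem for Unions. -/
/-- An atom (irreducible element) of a monoid: a non-unit `u` such that
`u = b * c` implies that `b` or `c` is a unit. -/
def IsMonAtom {M : Type*} [Monoid M] (u : M) : Prop :=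
  ¬ IsUnit u ∧ ∀ b c : M, u = b * c → IsUnit b ∨ IsUnit c

/-- A monoid is reduced if its only invertible element is `1`. -/
def MonReduced (M : Type*) [Monoid M] : Prop := ∀ u : M, IsUnit u → u = 1

/-- A monoid is (left and right) unit-cancellative if `a = a * u` or `a = u * a`
implies that `u` is a unit. -/
def UnitCancellative (M : Type*) [Monoid M] : Prop :=
  (∀ a u : M, a * u = a → IsUnit u) ∧ (∀ a u : M, u * a = a → IsUnit u)

/-- A monoid is atomic if every non-unit is a finite product of atoms. -/
def MonAtomic (M : Type*) [Monoid M] : Prop :=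
  ∀ a : M, ¬ IsUnit a → ∃ l : List M, (∀ u ∈ l, IsMonAtom u) ∧ l.prod = a

attribute [local instance] Classical.propDecidable

/-- The set of lengths `L(a)` of an element: the set of all `k ∈ ℕ` such that `a`
is a product of `k` atoms, with the convention `L(1) = {0}`. -/
noncomputable def setOfLengths {M : Type*} [Monoid M] (x : M) : Set ℕ :=
  if x = 1 then {0}
  else {k | ∃ l : List M, l.length = k ∧ (∀ u ∈ l, IsMonAtom u) ∧ l.prod = x}

/-- The system of sets of lengths `𝓛(M) = {L(a) : a ∈ M}`. -/
def LSystem (M : Type*) [Monoid M] : Set (Set ℕ) :=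
  Set.range (setOfLengths (M := M))

/-- `U_k(M)`, the union of all sets of lengths containing `k`. -/
def unionOfLengths (M : Type*) [Monoid M] (k : ℕ) : Set ℕ :=
  ⋃₀ {L | L ∈ LSystem M ∧ k ∈ L}
open scoped ENNReal

/-- The elasticity `ρ(L)` of a set `L ⊆ ℕ₀`:
`ρ(L) = sup(L∩ℕ)/min(L∩ℕ)` if `L ∩ ℕ ≠ ∅` and `ρ(L) = 1` otherwise. -/
noncomputable def setElasticity (L : Set ℕ) : ℝ≥0∞ :=
  if (L \ {0}).Nonempty then
    sSup ((fun k : ℕ => (k : ℝ≥0∞)) '' (L \ {0})) / ((sInf (L \ {0}) : ℕ) : ℝ≥0∞)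
  else 1

/-- The elasticity `ρ(M) = sup {ρ(L) : L ∈ 𝓛(M)}` of a monoid. -/
noncomputable def monElasticity (M : Type*) [Monoid M] : ℝ≥0∞ :=
  sSup (setElasticity '' LSystem M)

/-- A monoid has accepted elasticity if some `L ∈ 𝓛(M)` satisfies
`ρ(L) = ρ(M) < ∞`. -/
def AcceptedElasticity (M : Type*) [Monoid M] : Prop :=
  ∃ L ∈ LSystem M, setElasticity L = monElasticity M ∧ monElasticity M < ⊤
/-- The factorization monoid `Z(M)`: the free monoid on the set of atoms of `M`. -/
abbrev FacM (M : Type*) [Monoid M] := FreeMonoid {u : M // IsMonAtom u}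

/-- The canonical epimorphism `π : Z(M) → M` mapping a formal word of atoms to
its product. -/
def facProd (M : Type*) [Monoid M] : FacM M →* M := FreeMonoid.lift Subtype.val

/-- The monoid of relations `~_M = {(x, y) ∈ Z(M) × Z(M) : π x = π y}`, as a
submonoid of `Z(M) × Z(M)`. -/
def relMonoid (M : Type*) [Monoid M] : Submonoid (FacM M × FacM M) where
  carrier := {p | facProd M p.1 = facProd M p.2}
  one_mem' := by simp
  mul_mem' := by
    intro p q hp hq
    simp only [Set.mem_setOf_eq, Prod.fst_mul, Prod.snd_mul, map_mul] at *
    rw [hp, hq]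
/-- A reduced atomic monoid is finitely presented if its set of atoms is finite
and the congruence `~_M` (the kernel of `π : Z(M) → M`) is generated, as a
congruence on `Z(M)`, by a finite set `R` of relations. -/
def IsFinitelyPresentedBy (M : Type*) [Monoid M]
    (R : Finset (FacM M × FacM M)) : Prop :=
  {u : M | IsMonAtom u}.Finite ∧
  (∀ p ∈ R, facProd M p.1 = facProd M p.2) ∧
  Con.ker (facProd M) = conGen (fun x y => (x, y) ∈ R)
open scoped ENat

/-- The supremum of a set of naturals, computed in `ℕ∞`. -/
noncomputable def natSetSup (L : Set ℕ) : ℕ∞ :=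
  sSup ((fun t : ℕ => (t : ℕ∞)) '' L)

/-- `ρ_k(M) = sup U_k(M) ∈ ℕ∞`. -/
noncomputable def rhoK (M : Type*) [Monoid M] (k : ℕ) : ℕ∞ :=
  natSetSup (unionOfLengths M k)

/-- `P` is a (possibly infinite) arithmetical progression with difference `d`:
it is nonempty, any two of its elements are congruent modulo `d`, and it contains
every element between two of its elements which is congruent to them modulo `d`. -/
def IsAPWithDiff (d : ℕ) (P : Set ℕ) : Prop :=
  P.Nonempty ∧ (∀ x ∈ P, ∀ y ∈ P, x ≤ y → d ∣ y - x) ∧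
    ∀ x ∈ P, ∀ y ∈ P, ∀ z : ℕ, x ≤ z → z ≤ y → d ∣ z - x → z ∈ P

/-- `L` is an almost arithmetical progression (AAP) with difference `d` and
bound `B`: `L ⊆ min L + dℤ`, and `L ∩ [min L + B, sup L − B]` is a nonempty
arithmetical progression with difference `d`. -/
def IsAAP (d B : ℕ) (L : Set ℕ) : Prop :=
  L.Nonempty ∧ (∀ x ∈ L, d ∣ x - sInf L) ∧
    IsAPWithDiff d {y | y ∈ L ∧ sInf L + B ≤ y ∧ (y : ℕ∞) + B ≤ natSetSup L}

/-- The system of sets of lengths of `M` satisfies the Structure Theorem for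
Unions: there are `d ∈ ℕ` and `B ∈ ℕ₀` such that `U_k(M)` is an AAP with
difference `d` and bound `B` for all sufficiently large `k`. -/
def SatisfiesStructureThmForUnions (M : Type*) [Monoid M] : Prop :=
  ∃ d : ℕ, 0 < d ∧ ∃ B : ℕ, ∃ K : ℕ, ∀ k : ℕ, K ≤ k → IsAAP d B (unionOfLengths M k)

/-- The lengths of the words in `Z(M)` representing `a`. -/
def wordLengths {M : Type*} [Monoid M] (a : M) : Set ℕ :=
  {k | ∃ w : FacM M, w.length = k ∧ facProd M w = a}

theorem wordLengths_add {M : Type*} [Monoid M] {a b : M} {k l : ℕ}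
    (hk : k ∈ wordLengths a) (hl : l ∈ wordLengths b) : k + l ∈ wordLengths (a * b) := by
  obtain ⟨v, rfl, rfl⟩ := hk
  obtain ⟨w, rfl, rfl⟩ := hl
  exact ⟨v * w, FreeMonoid.length_mul v w, map_mul _ v w⟩

theorem one_mem_wordLengths {M : Type*} [Monoid M] {u : M} (hu : IsMonAtom u) :
    1 ∈ wordLengths u :=
  ⟨FreeMonoid.of ⟨u, hu⟩, FreeMonoid.length_of _, by simp [facProd]⟩

theorem mem_wordLengths_iff {M : Type*} [Monoid M] {a : M} {k : ℕ} :
    k ∈ wordLengths a ↔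
      ∃ l : List M, l.length = k ∧ (∀ u ∈ l, IsMonAtom u) ∧ l.prod = a := by
  constructor
  · rintro ⟨w, rfl, rfl⟩
    refine ⟨w.toList.map Subtype.val, ?_, ?_, ?_⟩
    · simp [FreeMonoid.length]
    · intro u hu
      obtain ⟨v, -, rfl⟩ := List.mem_map.1 hu
      exact v.2
    · rw [facProd, FreeMonoid.lift_apply]
  · rintro ⟨l, rfl, hl, rfl⟩
    lift l to List {u : M // IsMonAtom u} using hl
    refine ⟨FreeMonoid.ofList l, ?_, ?_⟩
    · simp [FreeMonoid.length]
    · rw [facProd, FreeMonoid.lift_apply, FreeMonoid.toList_ofList]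

theorem isUnit_of_mul_eq_one_of_unitCancellative {M : Type*} [Monoid M]
    (hred : MonReduced M) (huc : UnitCancellative M) {a b : M} (h : a * b = 1) : IsUnit a := by
  have hba : b * a = 1 := hred _ (huc.2 b (b * a) (by rw [mul_assoc, h, mul_one]))
  exact ⟨⟨a, b, h, hba⟩, rfl⟩

theorem wordLengths_one {M : Type*} [Monoid M]
    (hred : MonReduced M) (huc : UnitCancellative M) : wordLengths (1 : M) = {0} := by
  ext k
  rw [mem_wordLengths_iff, Set.mem_singleton_iff]
  constructor
  · rintro ⟨l, rfl, hl, h⟩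
    cases l with
    | nil => rfl
    | cons u l =>
      rw [List.prod_cons] at h
      exact absurd (isUnit_of_mul_eq_one_of_unitCancellative hred huc h) (hl u (by simp)).1
  · rintro rfl
    exact ⟨[], rfl, by simp, rfl⟩

theorem setOfLengths_eq_wordLengths {M : Type*} [Monoid M]
    (hred : MonReduced M) (huc : UnitCancellative M) (a : M) :
    setOfLengths a = wordLengths a := by
  unfold setOfLengths
  split_ifs with h
  · rw [h, wordLengths_one hred huc]
  · ext k
    exact mem_wordLengths_iff.symm

theorem eq_zero_of_zero_mem_wordLengths {M : Type*} [Monoid M]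
    (hred : MonReduced M) (huc : UnitCancellative M) {a : M} {l : ℕ}
    (h : 0 ∈ wordLengths a) (hl : l ∈ wordLengths a) : l = 0 := by
  obtain ⟨v, hv, -, rfl⟩ := mem_wordLengths_iff.1 h
  rw [List.length_eq_zero_iff.1 hv, List.prod_nil, wordLengths_one hred huc] at hl
  exact hl

theorem mem_unionOfLengths_iff {M : Type*} [Monoid M]
    (hred : MonReduced M) (huc : UnitCancellative M) {k l : ℕ} :
    l ∈ unionOfLengths M k ↔ ∃ a : M, k ∈ wordLengths a ∧ l ∈ wordLengths a := by
  simp [unionOfLengths, LSystem, setOfLengths_eq_wordLengths hred huc]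

/-- Related words of a congruence generated by relations of length less than `D` are
connected by words whose lengths jump by less than `D`. -/
theorem exists_factorization_between {M : Type*} [Monoid M] {r : FacM M → FacM M → Prop} {D : ℕ}
    (hD : 0 < D) (hr : ∀ x y, r x y → x.length < D ∧ y.length < D)
    (hrel : ∀ x y, r x y → facProd M x = facProd M y)
    {x y : FacM M} (h : ConGen.Rel r x y) :
    facProd M x = facProd M y ∧ ∀ m,
      (x.length ≤ m ∧ m ≤ y.length ∨ y.length ≤ m ∧ m ≤ x.length) →
      ∃ z, facProd M z = facProd M x ∧ z.length ≤ m ∧ m < z.length + D := by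
  induction h with
  | of x y h =>
    refine ⟨hrel x y h, fun m hm => ?_⟩
    have := hr x y h
    rcases hm with hm | hm
    · exact ⟨x, rfl, by omega, by omega⟩
    · exact ⟨y, (hrel x y h).symm, by omega, by omega⟩
  | refl x => exact ⟨rfl, fun m hm => ⟨x, rfl, by omega, by omega⟩⟩
  | symm h ih =>
    refine ⟨ih.1.symm, fun m hm => ?_⟩
    rw [← ih.1]
    exact ih.2 m hm.symm
  | @trans x y z h₁ h₂ ih₁ ih₂ =>
    refine ⟨ih₁.1.trans ih₂.1, fun m hm => ?_⟩
    have hc : (x.length ≤ m ∧ m ≤ y.length ∨ y.length ≤ m ∧ m ≤ x.length) ∨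
        (y.length ≤ m ∧ m ≤ z.length ∨ z.length ≤ m ∧ m ≤ y.length) := by omega
    rcases hc with hc | hc
    · exact ih₁.2 m hc
    · rw [ih₁.1]
      exact ih₂.2 m hc
  | @mul x y z w h₁ h₂ ih₁ ih₂ =>
    refine ⟨by rw [map_mul, map_mul, ih₁.1, ih₂.1], fun m hm => ?_⟩
    rw [FreeMonoid.length_mul, FreeMonoid.length_mul] at hm
    have hc : (x.length + z.length ≤ m ∧ m ≤ y.length + z.length ∨
          y.length + z.length ≤ m ∧ m ≤ x.length + z.length) ∨
        (y.length + z.length ≤ m ∧ m ≤ y.length + w.length ∨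
          y.length + w.length ≤ m ∧ m ≤ y.length + z.length) := by omega
    rcases hc with hc | hc
    · obtain ⟨t, ht, h₁, h₂⟩ := ih₁.2 (m - z.length) (by omega)
      refine ⟨t * z, by rw [map_mul, map_mul, ht], ?_, ?_⟩ <;>
        rw [FreeMonoid.length_mul] <;> omega
    · obtain ⟨t, ht, h₁, h₂⟩ := ih₂.2 (m - y.length) (by omega)
      refine ⟨y * t, by rw [map_mul, map_mul, ht, ih₁.1], ?_, ?_⟩ <;>
        rw [FreeMonoid.length_mul] <;> omega

/-- In a finitely presented monoid, gaps in sets of lengths are bounded. -/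
theorem exists_gap_bound {M : Type*} [Monoid M] {R : Finset (FacM M × FacM M)}
    (hR : IsFinitelyPresentedBy M R) :
    ∃ D : ℕ, ∀ a : M, ∀ k ∈ wordLengths a, ∀ l ∈ wordLengths a, ∀ m, k ≤ m → m ≤ l →
      ∃ t ∈ wordLengths a, t ≤ m ∧ m < t + D := by
  obtain ⟨-, hrel, hker⟩ := hR
  refine ⟨∑ p ∈ R, (p.1.length + p.2.length) + 1, ?_⟩
  rintro a k ⟨x, rfl, rfl⟩ l ⟨y, rfl, hy⟩ m hkm hml
  have hxy : conGen (fun x y => (x, y) ∈ R) x y := by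
    rw [← hker]
    exact hy.symm
  have hlen : ∀ x y, (x, y) ∈ R → x.length < ∑ p ∈ R, (p.1.length + p.2.length) + 1 ∧
      y.length < ∑ p ∈ R, (p.1.length + p.2.length) + 1 := by
    intro x y h
    have := Finset.single_le_sum (f := fun p : FacM M × FacM M => p.1.length + p.2.length)
      (fun _ _ => Nat.zero_le _) h
    simp only at this
    omega
  obtain ⟨z, hz, h₁, h₂⟩ := (exists_factorization_between (Nat.succ_pos _) hlen
    (fun x y h => hrel (x, y) h) hxy).2 m (Or.inl ⟨hkm, hml⟩)
  exact ⟨z.length, ⟨z, rfl, hz⟩, h₁, h₂⟩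

theorem pow_lengths {M : Type*} [Monoid M] {L : M → Set ℕ}
    (hadd : ∀ a b, ∀ k ∈ L a, ∀ l ∈ L b, k + l ∈ L (a * b)) (h1 : 0 ∈ L 1)
    {a : M} {k : ℕ} (hk : k ∈ L a) (n : ℕ) : n * k ∈ L (a ^ n) := by
  induction n with
  | zero => simpa using h1
  | succ n ih =>
    rw [pow_succ, add_mul, one_mul]
    exact hadd _ _ _ ih _ hk

theorem pow_lengths_interval {M : Type*} [Monoid M] {L : M → Set ℕ}
    (hadd : ∀ a b, ∀ k ∈ L a, ∀ l ∈ L b, k + l ∈ L (a * b)) (h1 : 0 ∈ L 1)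
    {a : M} {s d : ℕ} (hs : s ∈ L a) (hsd : s + d ∈ L a) {i n : ℕ} (hi : i ≤ n) :
    n * s + i * d ∈ L (a ^ n) := by
  obtain ⟨j, rfl⟩ := Nat.exists_eq_add_of_le hi
  have := hadd _ _ _ (pow_lengths hadd h1 hsd i) _ (pow_lengths hadd h1 hs j)
  rw [← pow_add] at this
  convert this using 1
  ring

/-- The length differences form a subgroup of `ℤ`; its generator is itself a difference. -/
theorem exists_min_difference {M : Type*} [Monoid M] {L : M → Set ℕ}
    (hadd : ∀ a b, ∀ k ∈ L a, ∀ l ∈ L b, k + l ∈ L (a * b)) (h1 : 0 ∈ L 1) :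
    ∃ d s : ℕ, ∃ a : M, s ∈ L a ∧ s + d ∈ L a ∧
      ∀ b, ∀ k ∈ L b, ∀ l ∈ L b, (d : ℤ) ∣ (l : ℤ) - k := by
  let G : AddSubgroup ℤ :=
    { carrier := {z | ∃ a, ∃ k ∈ L a, ∃ l ∈ L a, z = (l : ℤ) - k}
      zero_mem' := ⟨1, 0, h1, 0, h1, by simp⟩
      add_mem' := by
        rintro _ _ ⟨a, k, hk, l, hl, rfl⟩ ⟨b, k', hk', l', hl', rfl⟩
        exact ⟨a * b, k + k', hadd _ _ _ hk _ hk', l + l', hadd _ _ _ hl _ hl',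
          by push_cast; ring⟩
      neg_mem' := by
        rintro _ ⟨a, k, hk, l, hl, rfl⟩
        exact ⟨a, l, hl, k, hk, by ring⟩ }
  obtain ⟨g, hg⟩ := Int.subgroup_cyclic G
  have hgG : g ∈ G := by
    rw [hg]
    exact AddSubgroup.subset_closure rfl
  have hdvd : ∀ b, ∀ k ∈ L b, ∀ l ∈ L b, g ∣ (l : ℤ) - k := by
    intro b k hk l hl
    have : (l : ℤ) - k ∈ G := ⟨b, k, hk, l, hl, rfl⟩
    rw [hg, AddSubgroup.mem_closure_singleton] at this
    obtain ⟨n, hn⟩ := this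
    exact ⟨n, by rw [← hn, smul_eq_mul, mul_comm]⟩
  obtain ⟨a, k, hk, l, hl, rfl⟩ := hgG
  rcases le_total k l with h | h
  · refine ⟨l - k, k, a, hk, by rwa [Nat.add_sub_cancel' h], fun b i hi j hj => ?_⟩
    rw [Nat.cast_sub h]
    exact hdvd b i hi j hj
  · refine ⟨k - l, l, a, hl, by rwa [Nat.add_sub_cancel' h], fun b i hi j hj => ?_⟩
    rw [Nat.cast_sub h, ← neg_sub, neg_dvd]
    exact hdvd b i hi j hj

/-- Multiplying by an element with a long progression of lengths fills in bounded gaps. -/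
theorem mem_lengths_mul_of_gap {M : Type*} [Monoid M] {L : M → Set ℕ}
    (hadd : ∀ a b, ∀ k ∈ L a, ∀ l ∈ L b, k + l ∈ L (a * b)) {D d s : ℕ}
    (hgap : ∀ a : M, ∀ k ∈ L a, ∀ l ∈ L a, ∀ m, k ≤ m → m ≤ l → ∃ t ∈ L a, t ≤ m ∧ m < t + D)
    (hd : 0 < d) (hdvd : ∀ b, ∀ k ∈ L b, ∀ l ∈ L b, (d : ℤ) ∣ (l : ℤ) - k)
    {c : M} (hc : ∀ i ≤ D, s + i * d ∈ L c) {b : M} {k l m : ℕ} (hk : k ∈ L b) (hl : l ∈ L b)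
    (hkm : k ≤ m) (hml : m ≤ l) (hm : (d : ℤ) ∣ (m : ℤ) - k) : s + m ∈ L (c * b) := by
  obtain ⟨t, ht, htm, hmt⟩ := hgap b k hk l hl m hkm hml
  obtain ⟨i, hi⟩ : d ∣ m - t := by
    have h := dvd_sub hm (hdvd b k hk t ht)
    rw [sub_sub_sub_cancel_right, ← Nat.cast_sub htm] at h
    exact_mod_cast h
  have hiD : i ≤ D := by
    have : i ≤ d * i := Nat.le_mul_of_pos_left i hd
    omega
  have h := hadd _ _ _ (hc i hiD) _ ht
  convert h using 1
  rw [mul_comm i d, ← hi]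
  omega

theorem isAAP_singleton (k : ℕ) : IsAAP 1 0 {k} := by
  refine ⟨⟨k, rfl⟩, fun _ _ => one_dvd _, ⟨k, rfl, ?_, ?_⟩, fun _ _ _ _ _ => one_dvd _, ?_⟩
  · simp
  · simp [natSetSup]
  · rintro x ⟨hx, h1, -⟩ y ⟨hy, -, h2⟩ z hxz hzy -
    have hz : z = x := le_antisymm (hzy.trans (le_of_eq (hy.trans hx.symm))) hxz
    subst hz
    have hzy' : z = y := hx.trans hy.symm
    exact ⟨hx, h1, hzy' ▸ h2⟩

theorem natSetSup_le {L : Set ℕ} {n : ℕ} (h : ∀ x ∈ L, x ≤ n) : natSetSup L ≤ n := by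
  refine sSup_le ?_
  rintro _ ⟨x, hx, rfl⟩
  exact Nat.cast_le.2 (h x hx)

theorem le_natSetSup {L : Set ℕ} {n : ℕ} (h : n ∈ L) : (n : ℕ∞) ≤ natSetSup L :=
  le_sSup ⟨n, h, rfl⟩

/-- A set of naturals, contained in a residue class modulo `d` and filling this class on
`[lo, hi]`, is an AAP if its elements lie within `B` of `[lo, hi]`. -/
theorem isAAP_of_filled {U : Set ℕ} {d B k lo hi : ℕ} (hk : k ∈ U)
    (hdvd : ∀ x ∈ U, (d : ℤ) ∣ (x : ℤ) - k)
    (hfill : ∀ m, lo ≤ m → m ≤ hi → (d : ℤ) ∣ (m : ℤ) - k → m ∈ U)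
    (hlo : ∀ x ∈ U, lo ≤ x + B) (hhi : ∀ x ∈ U, x ≤ hi + B)
    {x y : ℕ} (hx : x ∈ U) (hxk : x + B ≤ k) (hy : y ∈ U) (hyk : k + B ≤ y) : IsAAP d B U := by
  have hmin : sInf U ∈ U := Nat.sInf_mem ⟨k, hk⟩
  have hdvd' : ∀ x ∈ U, ∀ y ∈ U, x ≤ y → d ∣ y - x := by
    intro x hx y hy hxy
    have h := dvd_sub (hdvd y hy) (hdvd x hx)
    rw [sub_sub_sub_cancel_right, ← Nat.cast_sub hxy] at h
    exact_mod_cast h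
  have hsup : natSetSup U ≤ (hi + B : ℕ) := natSetSup_le hhi
  refine ⟨⟨k, hk⟩, fun x hx => hdvd' _ hmin _ hx (Nat.sInf_le hx), ⟨k, hk, ?_, ?_⟩, ?_, ?_⟩
  · exact (Nat.add_le_add_right (Nat.sInf_le hx) B).trans hxk
  · exact le_trans (by exact_mod_cast hyk) (le_natSetSup hy)
  · rintro x ⟨hx, -⟩ y ⟨hy, -⟩ hxy
    exact hdvd' x hx y hy hxy
  · rintro x ⟨hx, hx1, -⟩ y ⟨hy, -, hy2⟩ z hxz hzy hz
    refine ⟨hfill z ?_ ?_ ?_, hx1.trans hxz, le_trans ?_ hy2⟩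
    · have := hlo _ hmin
      omega
    · have h : ((y + B : ℕ) : ℕ∞) ≤ (hi + B : ℕ) := by
        push_cast
        exact hy2.trans (by exact_mod_cast hsup)
      have := Nat.cast_le.1 h
      omega
    · have h : (d : ℤ) ∣ ((z - x : ℕ) : ℤ) := Int.natCast_dvd_natCast.2 hz
      rw [Nat.cast_sub hxz] at h
      have := dvd_add h (hdvd x hx)
      rwa [sub_add_sub_cancel] at this
    · gcongr

/-- The Structure Theorem for Unions for a family of length sets with bounded gaps
and accepted elasticity `q / p`. -/
theorem exists_isAAP_unions {M : Type*} [Monoid M] {L : M → Set ℕ}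
    (hadd : ∀ a b, ∀ k ∈ L a, ∀ l ∈ L b, k + l ∈ L (a * b)) (h1 : 0 ∈ L 1)
    {u : M} (hu : 1 ∈ L u) {D : ℕ}
    (hgap : ∀ a : M, ∀ k ∈ L a, ∀ l ∈ L a, ∀ m, k ≤ m → m ≤ l → ∃ t ∈ L a, t ≤ m ∧ m < t + D)
    {a : M} {p q : ℕ} (hp : 0 < p) (hpa : p ∈ L a) (hqa : q ∈ L a)
    (hpq : ∀ b, ∀ k ∈ L b, ∀ l ∈ L b, l * p ≤ q * k) :
    ∃ d : ℕ, 0 < d ∧ ∃ B K : ℕ, ∀ k, K ≤ k → IsAAP d B {l | ∃ b, k ∈ L b ∧ l ∈ L b} := by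
  obtain ⟨d, s, e, hs, hsd, hdvd⟩ := exists_min_difference hadd h1
  have huk : ∀ k, k ∈ L (u ^ k) := fun k => by
    simpa using pow_lengths hadd h1 hu k
  rcases Nat.eq_zero_or_pos d with rfl | hd
  · refine ⟨1, one_pos, 0, 0, fun k _ => ?_⟩
    convert isAAP_singleton k using 1
    ext l
    constructor
    · rintro ⟨b, hk, hl⟩
      have := hdvd b k hk l hl
      rw [Nat.cast_zero, zero_dvd_iff, sub_eq_zero] at this
      exact_mod_cast this
    · rintro rfl
      exact ⟨_, huk l, huk l⟩
  have hlt : p < q := by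
    have h := hpq e s hs (s + d) hsd
    by_contra! hle
    have h2 : q * s ≤ p * s := Nat.mul_le_mul_right s hle
    nlinarith [Nat.mul_pos hd hp]
  have hc : ∀ i ≤ D, D * s + i * d ∈ L (e ^ D) := fun i hi =>
    pow_lengths_interval hadd h1 hs hsd hi
  set S := D * s with hS
  have hblock : ∀ n r t, t ∈ L a → n * t + r ∈ L (a ^ n * u ^ r) := fun n r t ht =>
    hadd _ _ _ (pow_lengths hadd h1 ht n) _ (huk r)
  have hfill : ∀ n r m, n * p + r ≤ m → m ≤ n * q + r →
      (d : ℤ) ∣ (m : ℤ) - (n * p + r : ℕ) → S + m ∈ L (e ^ D * (a ^ n * u ^ r)) :=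
    fun n r m h₁ h₂ h₃ =>
      mem_lengths_mul_of_gap hadd hgap hd hdvd hc (hblock n r p hpa) (hblock n r q hqa) h₁ h₂ h₃
  have hdqp : ∀ n r, (d : ℤ) ∣ ((n * q + r : ℕ) : ℤ) - (n * p + r : ℕ) := fun n r =>
    hdvd _ _ (hblock n r p hpa) _ (hblock n r q hqa)
  have hle : ∀ n, n * p ≤ n * q := fun n => Nat.mul_le_mul_left n hlt.le
  have hn : ∀ n, n * p + n ≤ n * q := fun n => by nlinarith
  refine ⟨d, hd, q * S + q + S, S + q * (q * S + q + S) + q, fun k hk => ?_⟩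
  set B := q * S + q + S with hB
  obtain ⟨j, rfl⟩ := Nat.exists_eq_add_of_le (show S ≤ k by omega)
  -- an element whose lengths reach down from `S + j`, and one whose lengths reach up
  obtain ⟨n, r, hr, hj⟩ : ∃ n r, r < q ∧ j = n * q + r :=
    ⟨j / q, j % q, Nat.mod_lt _ (by omega), (Nat.div_add_mod' j q).symm⟩
  obtain ⟨n', r', hr', hj'⟩ : ∃ n r, r < p ∧ j = n * p + r :=
    ⟨j / p, j % p, Nat.mod_lt _ hp, (Nat.div_add_mod' j p).symm⟩
  have hnB : B ≤ n := by
    by_contra! h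
    have : n * q + q ≤ B * q := by nlinarith
    nlinarith
  have hnB' : B ≤ n' := by
    by_contra! h
    have : n' * p + p ≤ B * p := by nlinarith
    have : B * p ≤ B * q := hle B
    nlinarith
  have hdown : ∀ m, n * p + r ≤ m → m ≤ j → (d : ℤ) ∣ (m : ℤ) - j →
      ∃ b, S + j ∈ L b ∧ S + m ∈ L b := by
    intro m h₁ h₂ h₃
    refine ⟨_, hfill n r j (by have := hle n; omega) hj.le ?_, hfill n r m h₁ (by omega) ?_⟩
    · rw [hj]
      exact hdqp n r
    · have := dvd_add h₃ (hj ▸ hdqp n r)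
      rwa [sub_add_sub_cancel] at this
  have hup : ∀ m, j ≤ m → m ≤ n' * q + r' → (d : ℤ) ∣ (m : ℤ) - j →
      ∃ b, S + j ∈ L b ∧ S + m ∈ L b := by
    intro m h₁ h₂ h₃
    refine ⟨_, hfill n' r' j hj'.ge (by omega) ?_, hfill n' r' m (by omega) h₂ ?_⟩
    · rw [← hj', sub_self]
      exact dvd_zero _
    · rwa [← hj']
  refine isAAP_of_filled (k := S + j) (lo := S + (n * p + r)) (hi := S + (n' * q + r'))
    (x := S + (n * p + r)) (y := S + (n' * q + r')) ⟨_, huk _, huk _⟩ ?_ ?_ ?_ ?_ ?_ ?_ ?_ ?_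
  · rintro x ⟨b, hb, hx⟩
    exact hdvd b _ hb _ hx
  · intro m h₁ h₂ h₃
    obtain ⟨m, rfl⟩ := Nat.exists_eq_add_of_le (show S ≤ m by omega)
    rw [Nat.cast_add, Nat.cast_add, add_sub_add_left_eq_sub] at h₃
    rcases le_total m j with h | h
    · exact hdown m (by omega) h h₃
    · exact hup m h (by omega) h₃
  · rintro x ⟨b, hb, hx⟩
    have h := hpq b x hx _ hb
    have hx' : n * p ≤ x := by
      by_contra! hlt'
      have : q * x < q * (n * p) := Nat.mul_lt_mul_of_pos_left hlt' (by omega)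
      have : n * q * p ≤ (S + j) * p := Nat.mul_le_mul_right p (by omega)
      nlinarith
    omega
  · rintro x ⟨b, hb, hx⟩
    have h := hpq b _ hb x hx
    have hx' : x ≤ n' * q + q * S + q := by
      by_contra! hlt'
      have h2 : (n' * q + q * S + q) * p < x * p := Nat.mul_lt_mul_of_pos_right hlt' hp
      have h3 : q * S ≤ q * S * p := Nat.le_mul_of_pos_right _ hp
      have h4 : q * r' ≤ q * p := Nat.mul_le_mul_left q hr'.le
      rw [hj'] at h
      nlinarith
    omega
  · refine hdown _ le_rfl (by have := hle n; omega) ?_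
    rw [hj, ← dvd_neg, neg_sub]
    exact hdqp n r
  · have := hn n
    omega
  · refine hup _ (by have := hle n'; omega) le_rfl ?_
    rw [hj']
    exact hdqp n' r'
  · have := hn n'
    omega

theorem exists_accepted_ratio {M : Type*} [Monoid M] (hred : MonReduced M)
    (huc : UnitCancellative M) {u : M} (hu : IsMonAtom u) (hacc : AcceptedElasticity M) :
    ∃ (a : M) (p q : ℕ), 0 < p ∧ p ∈ wordLengths a ∧ q ∈ wordLengths a ∧
      ∀ b : M, ∀ k ∈ wordLengths b, ∀ l ∈ wordLengths b, l * p ≤ q * k := by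
  obtain ⟨_, ⟨a, rfl⟩, hL, hfin⟩ := hacc
  have hratio : ∃ (a : M) (p q : ℕ), 0 < p ∧ p ∈ wordLengths a ∧ q ∈ wordLengths a ∧
      monElasticity M = (q : ℝ≥0∞) / p := by
    rw [← hL] at hfin ⊢
    unfold setElasticity at hfin ⊢
    rw [setOfLengths_eq_wordLengths hred huc] at hfin ⊢
    split_ifs at hfin ⊢ with hne
    · set T := wordLengths a \ {0} with hT
      have hp : sInf T ∈ T := Nat.sInf_mem hne
      have hsup : sSup ((fun k : ℕ => (k : ℝ≥0∞)) '' T) ≠ ⊤ := by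
        intro h
        rw [h, ENNReal.top_div_of_ne_top (ENNReal.natCast_ne_top _)] at hfin
        exact lt_irrefl _ hfin
      have hbdd : BddAbove T := by
        obtain ⟨n, hn⟩ := ENNReal.exists_nat_gt hsup
        refine ⟨n, fun x hx => ?_⟩
        have : (x : ℝ≥0∞) < n :=
          (le_sSup (Set.mem_image_of_mem (fun k : ℕ => (k : ℝ≥0∞)) hx)).trans_lt hn
        exact (Nat.cast_lt.1 this).le
      have hq : sSup T ∈ T := Nat.sSup_mem hne hbdd
      refine ⟨a, sInf T, sSup T, Nat.pos_of_ne_zero hp.2, hp.1, hq.1, ?_⟩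
      congr 1
      refine le_antisymm (sSup_le ?_) (le_sSup ⟨_, hq, rfl⟩)
      rintro _ ⟨x, hx, rfl⟩
      exact Nat.cast_le.2 (le_csSup hbdd hx)
    · exact ⟨u, 1, 1, one_pos, one_mem_wordLengths hu, one_mem_wordLengths hu, by simp⟩
  obtain ⟨a, p, q, hp, hpa, hqa, hρ⟩ := hratio
  refine ⟨a, p, q, hp, hpa, hqa, fun b k hk l hl => ?_⟩
  rcases Nat.eq_zero_or_pos k with rfl | hk0
  · simp [eq_zero_of_zero_mem_wordLengths hred huc hk hl]
  rcases Nat.eq_zero_or_pos l with rfl | hl0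
  · simp
  have hb : setElasticity (wordLengths b) ≤ (q : ℝ≥0∞) / p := by
    rw [← hρ, ← setOfLengths_eq_wordLengths hred huc]
    exact le_sSup ⟨_, ⟨b, rfl⟩, rfl⟩
  have hkT : k ∈ wordLengths b \ {0} := ⟨hk, hk0.ne'⟩
  have hlT : l ∈ wordLengths b \ {0} := ⟨hl, hl0.ne'⟩
  have hlk : (l : ℝ≥0∞) / k ≤ q / p := by
    refine le_trans ?_ hb
    rw [setElasticity, if_pos ⟨k, hkT⟩]
    exact ENNReal.div_le_div (le_sSup ⟨l, hlT, rfl⟩) (Nat.cast_le.2 (Nat.sInf_le hkT))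
  have hk' : (k : ℝ≥0∞) ≠ 0 := Nat.cast_ne_zero.2 hk0.ne'
  have hp' : (p : ℝ≥0∞) ≠ 0 := Nat.cast_ne_zero.2 hp.ne'
  rw [ENNReal.div_le_iff hk' (ENNReal.natCast_ne_top k), ← ENNReal.mul_div_right_comm,
    ENNReal.le_div_iff_mul_le (Or.inl hp') (Or.inl (ENNReal.natCast_ne_top p))] at hlk
  exact_mod_cast hlk

theorem exists_isMonAtom {M : Type*} [Monoid M] (hred : MonReduced M) (hatomic : MonAtomic M)
    (hnt : ∃ a : M, a ≠ 1) : ∃ u : M, IsMonAtom u := by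
  obtain ⟨a, ha⟩ := hnt
  obtain ⟨l, hl, rfl⟩ := hatomic a fun h => ha (hred a h)
  cases l with
  | nil => exact absurd rfl ha
  | cons u l => exact ⟨u, hl u (by simp)⟩

/-- Let `H ≠ {1}` be a reduced atomic unit-cancellative
finitely presented monoid with accepted elasticity. Then there is a bound
`M ∈ ℕ` with `ρ_k(H) − ρ_{k−1}(H) ≤ M` for all `k ≥ 2`, and `𝓛(H)` satisfies
the Structure Theorem for Unions. -/
theorem statement15 (H : Type*) [Monoid H] (hred : MonReduced H)
    (hatomic : MonAtomic H) (huc : UnitCancellative H) (hnt : ∃ a : H, a ≠ 1)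
    (hfp : ∃ R : Finset (FacM H × FacM H), IsFinitelyPresentedBy H R)
    (hacc : AcceptedElasticity H) :
    (∃ M : ℕ, 0 < M ∧ ∀ k : ℕ, 2 ≤ k →
      rhoK H k - rhoK H (k - 1) ≤ (M : ℕ∞)) ∧
    SatisfiesStructureThmForUnions H := by
  obtain ⟨R, hR⟩ := hfp
  obtain ⟨u, hu⟩ := exists_isMonAtom hred hatomic hnt
  obtain ⟨a, p, q, hp, hpa, hqa, hpq⟩ := exists_accepted_ratio hred huc hu hacc
  obtain ⟨D, hgap⟩ := exists_gap_bound hR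
  have hadd : ∀ a b : H, ∀ k ∈ wordLengths a, ∀ l ∈ wordLengths b, k + l ∈ wordLengths (a * b) :=
    fun _ _ _ hk _ hl => wordLengths_add hk hl
  have h1 : 0 ∈ wordLengths (1 : H) := by
    rw [wordLengths_one hred huc]
    rfl
  have hu1 := one_mem_wordLengths hu
  have hunion : ∀ k, unionOfLengths H k = {l | ∃ b : H, k ∈ wordLengths b ∧ l ∈ wordLengths b} :=
    fun k => Set.ext fun l => mem_unionOfLengths_iff hred huc
  constructor
  · have hq : 0 < q := by
      have := hpq u 1 hu1 1 hu1
      omega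
    refine ⟨q, hq, fun k hk => ?_⟩
    set n := (k - 1) / p
    set r := (k - 1) % p
    have hr : r < p := Nat.mod_lt _ hp
    have hk1 : n * p + r = k - 1 := Nat.div_add_mod' _ _
    have hlen : ∀ t ∈ wordLengths a, n * t + r ∈ wordLengths (a ^ n * u ^ r) := fun t ht =>
      hadd _ _ _ (pow_lengths hadd h1 ht n) _ (by simpa using pow_lengths hadd h1 hu1 r)
    have hlow : ((n * q + r : ℕ) : ℕ∞) ≤ rhoK H (k - 1) := by
      refine le_natSetSup ?_
      rw [hunion]
      exact ⟨_, hk1 ▸ hlen p hpa, hlen q hqa⟩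
    have hhigh : rhoK H k ≤ (n * q + q : ℕ) := by
      refine natSetSup_le fun x hx => ?_
      rw [hunion] at hx
      obtain ⟨b, hb, hx⟩ := hx
      have h := hpq b k hb x hx
      by_contra! hlt
      have h2 : (n * q + q) * p < x * p := Nat.mul_lt_mul_of_pos_right hlt hp
      have h3 : q * k ≤ q * (n * p + p) := Nat.mul_le_mul_left q (by omega)
      nlinarith
    rw [tsub_le_iff_left]
    refine hhigh.trans (le_trans ?_ (add_le_add_left hlow _))
    exact_mod_cast (by omega : n * q + q ≤ n * q + r + q)
  · obtain ⟨d, hd, B, K, h⟩ := exists_isAAP_unions hadd h1 hu1 hgap hp hpa hqa hpq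
    refine ⟨d, hd, B, K, fun k hk => ?_⟩
    rw [hunion]
    exact h k hk
end

section
/- Let H ≠ {1} be a reduced atomic unit-cancellative commutative monoid which is finitely generated. Then there is a bound M ∈ ℕ such that ρ_k(H) − ρ_{k−1}(H) ≤ M for all k ≥ 2, and 𝓛(H) satisfies the Structure Theorem for Unions. -/
attribute [local instance] Classical.propDecidable

open scoped ENat

/-- From a symmetric additive relation in which lowering the first entry by one moves the second
by at most `M`, one gets a path from `(k, l)` to the origin whose shifts to the line of first
entry `k` pass near every point between `k` and `l`. -/
lemma exists_near_shift {P : ℕ → ℕ → Prop} {M : ℕ} (hzero : ∀ l, P 0 l → l = 0)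
    (hstep : ∀ k l, P (k + 1) l → ∃ l', P k l' ∧ l ≤ l' + M ∧ l' ≤ l + M) :
    ∀ (k l : ℕ) (t : ℤ), P k l → min (k : ℤ) l ≤ t → t ≤ max (k : ℤ) l →
      ∃ m n : ℕ, m ≤ k ∧ P m n ∧ |(n + k - m : ℤ) - t| ≤ M + 1 ∧
        |(l : ℤ) - (n + k - m)| ≤ (M + 1) * (k - m) := by
  intro k
  induction k with
  | zero =>
    intro l t h h1 h2
    obtain rfl := hzero l h
    refine ⟨0, 0, le_rfl, h, ?_, ?_⟩
    · have : t = 0 := by simp at h1 h2; omega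
      subst this
      simp
      positivity
    · simp
  | succ k ih =>
    intro l t h h1 h2
    by_cases hlt : |(l : ℤ) - t| ≤ M + 1
    · exact ⟨k + 1, l, le_rfl, h, by simpa using hlt, by simp⟩
    · obtain ⟨l', hl', h3, h4⟩ := hstep k l h
      have h5 : min (k : ℤ) l' ≤ t - 1 ∧ t - 1 ≤ max (k : ℤ) l' := by
        push_cast at h1 h2
        have h6 : (M : ℤ) + 1 < l - t ∨ (M : ℤ) + 1 < t - l := by
          rcases abs_cases ((l : ℤ) - t) with h | h <;> omega
        omega
      obtain ⟨m, n, hm, hP, h6, h7⟩ := ih l' (t - 1) hl' h5.1 h5.2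
      refine ⟨m, n, by omega, hP, ?_, ?_⟩
      · convert h6 using 2
        push_cast
        ring
      · have e : (l : ℤ) - (n + (k + 1 : ℕ) - m) = (l - l' - 1) + (l' - (n + k - m)) := by
          push_cast
          ring
        have h8 : |(l : ℤ) - l' - 1| ≤ M + 1 := by
          rw [abs_le]
          constructor <;> omega
        rw [e]
        refine (abs_add_le _ _).trans ((add_le_add h8 h7).trans (le_of_eq ?_))
        push_cast
        ring

lemma rel_nsmul {P : ℕ → ℕ → Prop} (hrefl : ∀ k, P k k)
    (hadd : ∀ k l k' l', P k l → P k' l' → P (k + k') (l + l')) {k l : ℕ} (h : P k l) (j : ℕ) :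
    P (j * k) (j * l) := by
  induction j with
  | zero => simpa using hrefl 0
  | succ j ih => simpa [add_mul] using hadd _ _ _ _ ih h

/-- The differences of related pairs are multiples of some `d`, which is itself a difference. -/
lemma exists_diff_generator {P : ℕ → ℕ → Prop} (hrefl : ∀ k, P k k)
    (hsymm : ∀ k l, P k l → P l k)
    (hadd : ∀ k l k' l', P k l → P k' l' → P (k + k') (l + l')) :
    ∃ d a : ℕ, P a (a + d) ∧ ∀ k l, P k l → (d : ℤ) ∣ l - k := by
  let D : AddSubgroup ℤ :=
    { carrier := {z | ∃ k l : ℕ, P k l ∧ (l : ℤ) - k = z}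
      zero_mem' := ⟨0, 0, hrefl 0, by simp⟩
      add_mem' := by
        rintro _ _ ⟨k, l, h, rfl⟩ ⟨k', l', h', rfl⟩
        exact ⟨k + k', l + l', hadd _ _ _ _ h h', by push_cast; ring⟩
      neg_mem' := by
        rintro _ ⟨k, l, h, rfl⟩
        exact ⟨l, k, hsymm _ _ h, by ring⟩ }
  obtain ⟨z, hz⟩ := Int.subgroup_cyclic D
  have hzD : z ∈ D := by
    rw [hz]
    exact AddSubgroup.subset_closure rfl
  obtain ⟨k, l, h, hkl⟩ := hzD
  refine ⟨z.natAbs, min k l, ?_, ?_⟩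
  · rcases le_total k l with hle | hle
    · have : min k l + z.natAbs = l := by omega
      rw [this, min_eq_left hle]
      exact h
    · have : min k l + z.natAbs = k := by omega
      rw [this, min_eq_right hle]
      exact hsymm _ _ h
  · intro k' l' h'
    have hD : (l' : ℤ) - k' ∈ D := ⟨k', l', h', rfl⟩
    rw [hz, AddSubgroup.mem_closure_singleton] at hD
    obtain ⟨n, hn⟩ := hD
    rw [Int.natAbs_dvd]
    exact ⟨n, by rw [← hn, smul_eq_mul, mul_comm]⟩

/-- A wide symmetric arithmetical progression related to a single number. -/
lemma exists_wide_progression {P : ℕ → ℕ → Prop} (hrefl : ∀ k, P k k)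
    (hsymm : ∀ k l, P k l → P l k)
    (hadd : ∀ k l k' l', P k l → P k' l' → P (k + k') (l + l')) {a d : ℕ} (h : P a (a + d))
    (J : ℕ) : ∀ t : ℕ, (d : ℤ) ∣ t - (J * (a + d) : ℕ) →
      |(t : ℤ) - (J * (a + d) : ℕ)| ≤ J * d → P (J * (a + d)) t := by
  intro t ⟨j, hj⟩ hle
  rcases Nat.eq_zero_or_pos d with rfl | hd
  · have : t = J * (a + 0) := by
      zify
      simp only [Nat.cast_zero, zero_mul] at hj
      push_cast at hj
      linarith
    rw [this]
    exact hrefl _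
  have hjJ : j.natAbs ≤ J := by
    rw [hj, abs_mul, Nat.abs_cast, mul_comm] at hle
    have := le_of_mul_le_mul_right hle (by exact_mod_cast hd)
    rw [Int.abs_eq_natAbs] at this
    exact_mod_cast this
  obtain ⟨c, rfl⟩ := Nat.exists_eq_add_of_le hjJ
  rcases le_total 0 j with hj0 | hj0
  · obtain ⟨i, rfl⟩ := Int.eq_ofNat_of_zero_le hj0
    have := hadd _ _ _ _ (rel_nsmul hrefl hadd h i) (hrefl (i * d + c * (a + d)))
    simp only [Int.natAbs_natCast] at *
    convert this using 1
    · ring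
    · zify
      push_cast at hj
      linear_combination hj
  · obtain ⟨i, hi⟩ := Int.eq_ofNat_of_zero_le (neg_nonneg.2 hj0)
    obtain rfl : j = -(i : ℤ) := by omega
    have := hadd _ _ _ _ (rel_nsmul hrefl hadd (hsymm _ _ h) i) (hrefl (c * (a + d)))
    simp only [Int.natAbs_neg, Int.natAbs_natCast] at *
    convert this using 1
    · ring
    · zify
      push_cast at hj
      linear_combination hj

lemma natSetSup_eq {L : Set ℕ} {r : ℕ} (h : IsGreatest L r) : natSetSup L = r := by
  refine IsGreatest.csSup_eq ⟨⟨r, h.1, rfl⟩, ?_⟩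
  rintro _ ⟨t, ht, rfl⟩
  exact Nat.cast_le.2 (h.2 ht)

/-- A set of naturals around `k` in the class of `k` modulo `d`, with minimum and maximum far from
`k`, which is full between `k` and its extreme points up to a bound `B`, is an AAP. -/
lemma isAAP_of_full_between {d B k r : ℕ} {L : Set ℕ} (hk : k ∈ L) (hr : IsGreatest L r)
    (hmod : ∀ l ∈ L, (d : ℤ) ∣ l - k)
    (hfull : ∀ l ∈ L, ∀ t : ℕ, min (k : ℤ) l ≤ t → (t : ℤ) ≤ max (k : ℤ) l →
      (d : ℤ) ∣ t - k → (B : ℤ) ≤ |(l : ℤ) - t| → t ∈ L)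
    (hlo : ∃ l ∈ L, l + B ≤ k) (hhi : ∃ l ∈ L, k + B ≤ l) : IsAAP d B L := by
  have hmin : sInf L ∈ L := Nat.sInf_mem ⟨k, hk⟩
  have hmod' : ∀ x ∈ L, ∀ y ∈ L, x ≤ y → d ∣ y - x := by
    intro x hx y hy hxy
    zify [hxy]
    simpa using dvd_sub (hmod y hy) (hmod x hx)
  obtain ⟨l₁, hl₁, hlk⟩ := hlo
  obtain ⟨l₂, hl₂, hkl⟩ := hhi
  refine ⟨⟨k, hk⟩, fun x hx => hmod' _ hmin _ hx (Nat.sInf_le hx), ⟨k, hk, ?_, ?_⟩, ?_, ?_⟩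
  · have := Nat.sInf_le hl₁
    omega
  · rw [natSetSup_eq hr]
    exact_mod_cast hkl.trans (hr.2 hl₂)
  · exact fun x hx y hy hxy => hmod' x hx.1 y hy.1 hxy
  · rintro x ⟨hx, hx1, -⟩ y ⟨-, -, hy⟩ z hxz hzy hdz
    rw [natSetSup_eq hr] at hy ⊢
    have hyr : y + B ≤ r := by exact_mod_cast hy
    have hzr : z + B ≤ r := by omega
    refine ⟨?_, hx1.trans hxz, by exact_mod_cast hzr⟩
    have hdk : (d : ℤ) ∣ z - k := by
      zify [hxz] at hdz
      simpa using dvd_add hdz (hmod x hx)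
    rcases le_total z k with hzk | hzk
    · refine hfull _ hmin z ?_ ?_ hdk ?_
      · exact (min_le_right _ _).trans (by omega)
      · exact le_max_of_le_left (by omega)
      · rw [abs_sub_comm]
        exact le_trans (by omega) (le_abs_self _)
    · refine hfull _ hr.1 z ?_ ?_ hdk ?_
      · exact min_le_of_left_le (by omega)
      · exact le_max_of_le_right (by omega)
      · exact le_trans (by omega) (le_abs_self _)

/-- The structure theorem for unions in purely combinatorial form. -/
lemma exists_isAAP_of_rel {P : ℕ → ℕ → Prop} {M : ℕ} (hrefl : ∀ k, P k k)
    (hsymm : ∀ k l, P k l → P l k)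
    (hadd : ∀ k l k' l', P k l → P k' l' → P (k + k') (l + l'))
    (hzero : ∀ l, P 0 l → l = 0) (hbdd : ∀ k, ∃ r, ∀ l, P k l → l ≤ r)
    (hstep : ∀ k l, P (k + 1) l → ∃ l', P k l' ∧ l ≤ l' + M ∧ l' ≤ l + M) :
    ∃ d : ℕ, 0 < d ∧ ∃ B K : ℕ, ∀ k, K ≤ k → IsAAP d B {l | P k l} := by
  have hgreatest : ∀ k, ∃ r, IsGreatest {l | P k l} r := by
    intro k
    obtain ⟨r, hr⟩ := hbdd k
    have hb : BddAbove {l | P k l} := ⟨r, hr⟩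
    exact ⟨_, Nat.sSup_mem ⟨k, hrefl k⟩ hb, fun _ hx => le_csSup hb hx⟩
  obtain ⟨d, a, had, hdvd⟩ := exists_diff_generator hrefl hsymm hadd
  rcases Nat.eq_zero_or_pos d with rfl | hd
  · have heq : ∀ k l, P k l → l = k := by
      intro k l h
      have := hdvd k l h
      simp only [Nat.cast_zero, zero_dvd_iff] at this
      omega
    refine ⟨1, one_pos, 0, 0, fun k _ => ?_⟩
    obtain ⟨r, hr⟩ := hgreatest k
    refine isAAP_of_full_between (hrefl k) hr (fun _ _ => by simp) ?_ ⟨k, hrefl k, le_rfl⟩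
      ⟨k, hrefl k, le_rfl⟩
    intro l hl t h1 h2 _ _
    obtain rfl := heq k l hl
    have : t = l := by simp at h1 h2; omega
    rwa [this]
  · set c := (M + 1) * (a + d) with hc
    set B := (M + 1) * (c + 1) + 1 with hB
    refine ⟨d, hd, B, B * (a + d), fun k hk => ?_⟩
    obtain ⟨r, hr⟩ := hgreatest k
    have hup := hadd _ _ _ _ (rel_nsmul hrefl hadd had B) (hrefl (k - B * a))
    have hdown := hadd _ _ _ _ (rel_nsmul hrefl hadd (hsymm _ _ had) B) (hrefl (k - B * (a + d)))
    have hBd : B ≤ B * d := Nat.le_mul_of_pos_right _ hd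
    rw [mul_add] at hk hup hdown
    refine isAAP_of_full_between (hrefl k) hr (hdvd k) ?_ ⟨B * a + (k - (B * a + B * d)), ?_, ?_⟩
      ⟨B * a + B * d + (k - B * a), ?_, ?_⟩
    · intro l hl t h1 h2 hdt hBt
      obtain ⟨m, n, hm, hP, h3, h4⟩ := exists_near_shift hzero hstep k l t hl h1 h2
      have hmc : m + c ≤ k := by
        by_contra! hlt
        have h5 : |(l : ℤ) - t| ≤ (M + 1) * (k - m) + (M + 1) := by
          have : (l : ℤ) - t = (l - (n + k - m)) + ((n + k - m) - t) := by ring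
          rw [this]
          exact (abs_add_le _ _).trans (add_le_add h4 h3)
        have h6 : ((M : ℤ) + 1) * (k - m) ≤ (M + 1) * c :=
          mul_le_mul_of_nonneg_left (by omega) (by positivity)
        have h7 : (B : ℤ) = (M + 1) * (c + 1) + 1 := by
          rw [hB]
          push_cast
          ring
        linarith
      have hcM : M + 1 ≤ c := by
        rw [hc]
        exact Nat.le_mul_of_pos_right _ (by omega)
      have hnt : n + (k - m - c) ≤ t := by
        have := (abs_le.1 h3).2
        omega
      obtain ⟨s, rfl⟩ := Nat.exists_eq_add_of_le hnt
      have hs : ((n + (k - m - c) + s : ℕ) : ℤ) = n + k - m - c + s := by omega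
      rw [hs] at hdt h3
      have hPs : P c s := by
        refine exists_wide_progression hrefl hsymm hadd had (M + 1) s ?_ ?_
        · rw [← hc]
          have e : (s : ℤ) - c = (n + k - m - c + s - k) - (n - m) := by ring
          rw [e]
          exact dvd_sub hdt (hdvd m n hP)
        · rw [← hc, abs_sub_comm]
          have e : (n + k - m : ℤ) - (n + k - m - c + s) = c - s := by ring
          rw [e] at h3
          refine h3.trans ?_
          push_cast
          exact le_mul_of_one_le_right (by positivity) (by exact_mod_cast hd)
      have := hadd _ _ _ _ (hadd _ _ _ _ hP (hrefl (k - m - c))) hPs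
      have e : m + (k - m - c) + c = k := by omega
      rwa [e] at this
    · have e : B * a + B * d + (k - (B * a + B * d)) = k := by omega
      rwa [e] at hdown
    · omega
    · have e : B * a + (k - B * a) = k := by omega
      rwa [e] at hup
    · omega

/-- In a finitely generated commutative monoid the congruences `x ^ n * a = x ^ n * b`
stabilize. -/
lemma exists_pow_mul_cancel {H : Type*} [CommMonoid H] (hfg : Monoid.FG H) (x : H) :
    ∃ n : ℕ, ∀ a b : H, x ^ (n + 1) * a = x ^ (n + 1) * b → x ^ n * a = x ^ n * b := by
  have : IsNoetherianRing (MonoidAlgebra ℤ H) := Algebra.FiniteType.isNoetherianRing ℤ _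
  obtain ⟨n, hn⟩ := monotone_stabilizes_iff_noetherian.2 this
    (LinearMap.iterateKer (LinearMap.mulLeft (MonoidAlgebra ℤ H) (MonoidAlgebra.of ℤ H x)))
  have hmem : ∀ (m : ℕ) (a b : H), MonoidAlgebra.of ℤ H a - MonoidAlgebra.of ℤ H b ∈
      LinearMap.iterateKer
        (LinearMap.mulLeft (MonoidAlgebra ℤ H) (MonoidAlgebra.of ℤ H x)) m ↔
      x ^ m * a = x ^ m * b := by
    intro m a b
    change _ ∈ LinearMap.ker (_ ^ m) ↔ _
    rw [LinearMap.mem_ker, LinearMap.pow_mulLeft, LinearMap.mulLeft_apply, mul_sub, sub_eq_zero,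
      ← map_pow, ← map_mul, ← map_mul]
    exact MonoidAlgebra.of_injective.eq_iff
  refine ⟨n, fun a b h => ?_⟩
  rw [← hmem, hn (n + 1) (by omega), hmem]
  exact h

/-- Dickson's lemma: every subset of `ι → ℕ` lies above finitely many of its members. -/
lemma exists_finite_below {ι : Type*} [Finite ι] (s : Set (ι → ℕ)) :
    ∃ t ⊆ s, t.Finite ∧ ∀ f ∈ s, ∃ g ∈ t, g ≤ f := by
  refine ⟨{g | Minimal (· ∈ s) g}, fun g hg => hg.prop, ?_, fun f hf => ?_⟩
  · exact (wellQuasiOrderedLE_iff.1 inferInstance).2 _ (setOfPred_minimal_antichain _)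
  · obtain ⟨g, hle, hg⟩ := exists_minimal_le_of_wellFoundedLT (· ∈ s) f hf
    exact ⟨g, hg, hle⟩

/-- The product `∏ u i ^ f i` encoded by the exponent vector `f`. -/
def vectorProd {H ι : Type*} [CommMonoid H] [Fintype ι] (u : ι → H) (f : ι → ℕ) : H :=
  ∏ i, u i ^ f i

lemma vectorProd_add {H ι : Type*} [CommMonoid H] [Fintype ι] (u : ι → H) (f g : ι → ℕ) :
    vectorProd u (f + g) = vectorProd u f * vectorProd u g := by
  simp [vectorProd, pow_add, Finset.prod_mul_distrib]

lemma vectorProd_single {H ι : Type*} [CommMonoid H] [Fintype ι] [DecidableEq ι] (u : ι → H)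
    (i : ι) (n : ℕ) : vectorProd u (Pi.single i n) = u i ^ n := by
  unfold vectorProd
  rw [Finset.prod_eq_single i]
  · simp
  · intro j _ hj
    simp [hj]
  · simp

lemma vectorProd_eq_one {H ι : Type*} [CommMonoid H] [Fintype ι] {u : ι → H}
    (hred : MonReduced H) (hu : ∀ i, u i ≠ 1) {f : ι → ℕ} (h : vectorProd u f = 1) : f = 0 := by
  funext i
  by_contra hi
  have h1 : IsUnit (u i ^ f i) :=
    isUnit_of_dvd_one (h ▸ Finset.dvd_prod_of_mem _ (Finset.mem_univ i))
  exact hu i (hred _ ((isUnit_pow_iff hi).1 h1))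

/-- The number pairs `(k, l)` such that some element is a product of `k` and of `l` factors from
the family `u`. -/
def LengthRel {H ι : Type*} [CommMonoid H] [Fintype ι] (u : ι → H) (k l : ℕ) : Prop :=
  ∃ f g : ι → ℕ, vectorProd u f = vectorProd u g ∧ ∑ i, f i = k ∧ ∑ i, g i = l

lemma LengthRel.symm {H ι : Type*} [CommMonoid H] [Fintype ι] {u : ι → H} {k l : ℕ}
    (h : LengthRel u k l) : LengthRel u l k := by
  obtain ⟨f, g, h, hf, hg⟩ := h
  exact ⟨g, f, h.symm, hg, hf⟩

lemma LengthRel.add {H ι : Type*} [CommMonoid H] [Fintype ι] {u : ι → H} {k l k' l' : ℕ}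
    (h : LengthRel u k l) (h' : LengthRel u k' l') : LengthRel u (k + k') (l + l') := by
  obtain ⟨f, g, h, rfl, rfl⟩ := h
  obtain ⟨f', g', h', rfl, rfl⟩ := h'
  exact ⟨f + f', g + g', by rw [vectorProd_add, vectorProd_add, h, h'],
    by simp [Finset.sum_add_distrib], by simp [Finset.sum_add_distrib]⟩

lemma LengthRel.refl {H ι : Type*} [CommMonoid H] [Fintype ι] [Nonempty ι] (u : ι → H) (k : ℕ) :
    LengthRel u k k := by
  classical
  obtain ⟨i⟩ := ‹Nonempty ι›
  exact ⟨Pi.single i k, Pi.single i k, rfl, by simp, by simp⟩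

lemma LengthRel.eq_zero {H ι : Type*} [CommMonoid H] [Fintype ι] {u : ι → H}
    (hred : MonReduced H) (hu : ∀ i, u i ≠ 1) {l : ℕ} (h : LengthRel u 0 l) : l = 0 := by
  obtain ⟨f, g, h, hf, rfl⟩ := h
  have hf0 : f = 0 := by
    funext i
    exact Finset.sum_eq_zero_iff.1 hf i (Finset.mem_univ i)
  have hg : g = 0 := vectorProd_eq_one hred hu (by rw [← h, hf0]; simp [vectorProd])
  simp [hg]

lemma LengthRel.exists_bound {H ι : Type*} [CommMonoid H] [Fintype ι] {u : ι → H}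
    (hred : MonReduced H) (huc : UnitCancellative H) (hu : ∀ i, u i ≠ 1) (k : ℕ) :
    ∃ r, ∀ l, LengthRel u k l → l ≤ r := by
  have hfib : ∀ f : ι → ℕ, {g | vectorProd u f = vectorProd u g}.Finite := by
    intro f
    refine (wellQuasiOrderedLE_iff.1 inferInstance).2 _ ?_
    intro g hg g' hg' hne hle
    obtain ⟨h, rfl⟩ := exists_add_of_le hle
    have h1 : vectorProd u g * vectorProd u h = vectorProd u g := by
      rw [← vectorProd_add]
      exact hg'.symm.trans hg
    have h2 : h = 0 := vectorProd_eq_one hred hu (hred _ (huc.1 _ _ h1))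
    simp [h2] at hne
  have hfin : {f : ι → ℕ | ∑ i, f i = k}.Finite := by
    refine (Set.finite_Iic (fun _ : ι => k)).subset ?_
    rintro f rfl i
    exact Finset.single_le_sum (fun _ _ => Nat.zero_le _) (Finset.mem_univ i)
  obtain ⟨r, hr⟩ := ((hfin.biUnion fun f _ => hfib f).image fun g => ∑ i, g i).bddAbove
  refine ⟨r, ?_⟩
  rintro l ⟨f, g, h, hf, rfl⟩
  exact hr ⟨g, Set.mem_biUnion hf h, rfl⟩

/-- If the factor `u i` occurs often enough in `f`, one copy of it can be removed from `f` while
changing the length of another factorization of the same element by a bounded amount. -/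
lemma exists_remove_factor {H ι : Type*} [CommMonoid H] [Fintype ι] {u : ι → H}
    (hfg : Monoid.FG H) (hgen : ∀ a : H, ∃ f, vectorProd u f = a) (i : ι) :
    ∃ N C : ℕ, ∀ f g : ι → ℕ, vectorProd u f = vectorProd u g → N < f i →
      ∃ f' g' : ι → ℕ, vectorProd u f' = vectorProd u g' ∧ ∑ j, f' j + 1 = ∑ j, f j ∧
        ∑ j, g j ≤ ∑ j, g' j + C ∧ ∑ j, g' j ≤ ∑ j, g j + C := by
  classical
  obtain ⟨N, hN⟩ := exists_pow_mul_cancel hfg (u i)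
  obtain ⟨t, hts, htfin, ht⟩ :=
    exists_finite_below {f : ι → ℕ | u i ^ (N + 1) ∣ vectorProd u f}
  have hz : ∀ y ∈ t, ∃ z, vectorProd u y = u i ^ (N + 1) * vectorProd u z := by
    intro y hy
    obtain ⟨a, ha⟩ := hts hy
    obtain ⟨z, rfl⟩ := hgen a
    exact ⟨z, ha⟩
  choose! z hz using hz
  obtain ⟨C, hC⟩ := (htfin.image fun y => ∑ j, y j + ∑ j, z y j).bddAbove
  refine ⟨N, C + N, fun f g hfg' hNf => ?_⟩
  have hsingle : Pi.single i (N + 1) ≤ f := by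
    intro j
    by_cases hj : j = i
    · subst hj
      simpa using hNf
    · simp [hj]
  obtain ⟨x, rfl⟩ := exists_add_of_le hsingle
  rw [vectorProd_add, vectorProd_single] at hfg'
  obtain ⟨y, hy, hyg⟩ := ht g (Dvd.intro _ hfg')
  obtain ⟨w, rfl⟩ := exists_add_of_le hyg
  have hCy : ∑ j, y j + ∑ j, z y j ≤ C := hC ⟨y, hy, rfl⟩
  rw [vectorProd_add, hz y hy, mul_assoc, ← vectorProd_add] at hfg'
  refine ⟨Pi.single i N + x, Pi.single i N + (z y + w), ?_, ?_, ?_, ?_⟩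
  · rw [vectorProd_add, vectorProd_add, vectorProd_single]
    exact hN _ _ hfg'
  all_goals
    simp only [Pi.add_apply, Finset.sum_add_distrib, Finset.sum_pi_single', Finset.mem_univ,
      if_true]
    omega

/-- Lowering one length by one moves the other by a bounded amount. -/
lemma LengthRel.exists_step {H ι : Type*} [CommMonoid H] [Fintype ι] [Nonempty ι] {u : ι → H}
    (hred : MonReduced H) (huc : UnitCancellative H) (hu : ∀ i, u i ≠ 1)
    (hfg : Monoid.FG H) (hgen : ∀ a : H, ∃ f, vectorProd u f = a) :
    ∃ M : ℕ, ∀ k l, LengthRel u (k + 1) l →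
      ∃ l', LengthRel u k l' ∧ l ≤ l' + M ∧ l' ≤ l + M := by
  choose N C hNC using exists_remove_factor hfg hgen
  choose r hr using LengthRel.exists_bound hred huc hu
  set K := ∑ i, N i with hK
  refine ⟨∑ i, C i + (∑ k ∈ Finset.range (K + 1), r k + K), fun k l h => ?_⟩
  by_cases hk : k + 1 ≤ K
  · refine ⟨k, LengthRel.refl u k, ?_, by omega⟩
    have h1 := hr _ _ h
    have h2 : r (k + 1) ≤ ∑ k ∈ Finset.range (K + 1), r k :=
      Finset.single_le_sum (fun _ _ => Nat.zero_le _) (Finset.mem_range.2 (by omega))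
    omega
  · obtain ⟨f, g, hfg', hf, rfl⟩ := h
    obtain ⟨i, -, hi⟩ : ∃ i ∈ Finset.univ, N i < f i :=
      Finset.exists_lt_of_sum_lt (by omega)
    obtain ⟨f', g', h1, h2, h3, h4⟩ := hNC i f g hfg' hi
    have hCi : C i ≤ ∑ i, C i :=
      Finset.single_le_sum (fun _ _ => Nat.zero_le _) (Finset.mem_univ i)
    exact ⟨_, ⟨f', g', h1, by omega, rfl⟩, by omega, by omega⟩

lemma finite_setOf_isMonAtom {H : Type*} [CommMonoid H] (hred : MonReduced H)
    (hfg : Monoid.FG H) : {u : H | IsMonAtom u}.Finite := by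
  obtain ⟨S, hS⟩ := Monoid.fg_def.1 hfg
  refine S.finite_toSet.subset fun u hu => ?_
  have hmem : u ∈ Submonoid.closure (S : Set H) := by
    rw [hS]
    trivial
  obtain ⟨l, hl, rfl⟩ := Submonoid.exists_list_of_mem_closure hmem
  induction l with
  | nil => exact absurd (by simp) hu.1
  | cons a l ih =>
    rw [List.prod_cons] at hu hmem ⊢
    rcases hu.2 _ _ rfl with h | h
    · rw [hred _ h, one_mul] at hu hmem ⊢
      exact ih (fun y hy => hl y (List.mem_cons_of_mem _ hy)) hu hmem
    · rw [hred _ h, mul_one]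
      exact hl a List.mem_cons_self

lemma exists_list_iff_exists_vector {H : Type*} [CommMonoid H] [Fintype {u : H // IsMonAtom u}]
    (x : H) (k : ℕ) :
    (∃ l : List H, l.length = k ∧ (∀ u ∈ l, IsMonAtom u) ∧ l.prod = x) ↔
      ∃ f : {u : H // IsMonAtom u} → ℕ, ∑ i, f i = k ∧ vectorProd Subtype.val f = x := by
  classical
  constructor
  · rintro ⟨l, rfl, hl, rfl⟩
    induction l with
    | nil => exact ⟨0, by simp, by simp [vectorProd]⟩
    | cons a l ih =>
      obtain ⟨f, hf, hfx⟩ := ih fun u hu => hl u (List.mem_cons_of_mem _ hu)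
      refine ⟨Pi.single ⟨a, hl a List.mem_cons_self⟩ 1 + f, ?_, ?_⟩
      · simp [Finset.sum_add_distrib, hf, add_comm]
      · rw [vectorProd_add, vectorProd_single, hfx, List.prod_cons, pow_one]
  · rintro ⟨f, rfl, rfl⟩
    refine ⟨(∑ i, Multiset.replicate (f i) i.1).toList, ?_, ?_, ?_⟩
    · simp
    · intro u hu
      rw [Multiset.mem_toList, Multiset.mem_sum] at hu
      obtain ⟨i, -, hi⟩ := hu
      rw [Multiset.eq_of_mem_replicate hi]
      exact i.2
    · rw [Multiset.prod_toList, Multiset.prod_sum]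
      simp [vectorProd]

lemma mem_setOfLengths {H : Type*} [CommMonoid H] [Fintype {u : H // IsMonAtom u}]
    (hred : MonReduced H) (x : H) (k : ℕ) :
    k ∈ setOfLengths x ↔
      ∃ f : {u : H // IsMonAtom u} → ℕ, ∑ i, f i = k ∧ vectorProd Subtype.val f = x := by
  unfold setOfLengths
  split_ifs with hx
  · subst hx
    constructor
    · rintro rfl
      exact ⟨0, by simp, by simp [vectorProd]⟩
    · rintro ⟨f, rfl, hf⟩
      have : f = 0 := vectorProd_eq_one hred (fun i h => i.2.1 (h ▸ isUnit_one)) hf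
      simp [this]
  · exact exists_list_iff_exists_vector x k

lemma unionOfLengths_eq {H : Type*} [CommMonoid H] [Fintype {u : H // IsMonAtom u}]
    (hred : MonReduced H) (k : ℕ) :
    unionOfLengths H k = {l | LengthRel (Subtype.val : {u : H // IsMonAtom u} → H) k l} := by
  ext l
  constructor
  · rintro ⟨_, ⟨⟨x, rfl⟩, hk⟩, hl⟩
    obtain ⟨f, hf, hfx⟩ := (mem_setOfLengths hred x k).1 hk
    obtain ⟨g, hg, hgx⟩ := (mem_setOfLengths hred x l).1 hl
    exact ⟨f, g, hfx.trans hgx.symm, hf, hg⟩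
  · rintro ⟨f, g, h, hf, hg⟩
    exact ⟨_, ⟨⟨_, rfl⟩, (mem_setOfLengths hred _ k).2 ⟨f, hf, rfl⟩⟩,
      (mem_setOfLengths hred _ l).2 ⟨g, hg, h.symm⟩⟩

/-- Let `H ≠ {1}` be a reduced atomic unit-cancellative
commutative finitely generated monoid. Then there is a bound `M ∈ ℕ` with
`ρ_k(H) − ρ_{k−1}(H) ≤ M` for all `k ≥ 2`, and `𝓛(H)` satisfies the Structure
Theorem for Unions. -/
theorem statement17 (H : Type*) [CommMonoid H] (hred : MonReduced H)
    (hatomic : MonAtomic H) (huc : UnitCancellative H)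
    (hnt : ∃ a : H, a ≠ 1) (hfg : Monoid.FG H) :
    (∃ M : ℕ, 0 < M ∧ ∀ k : ℕ, 2 ≤ k →
      rhoK H k - rhoK H (k - 1) ≤ (M : ℕ∞)) ∧
    SatisfiesStructureThmForUnions H := by
  obtain ⟨a, ha⟩ := hnt
  have : Fintype {u : H // IsMonAtom u} := (finite_setOf_isMonAtom hred hfg).fintype
  have hu : ∀ i : {u : H // IsMonAtom u}, i.1 ≠ 1 := fun i h => i.2.1 (h ▸ isUnit_one)
  have hgen : ∀ x : H, ∃ f, vectorProd (Subtype.val : {u : H // IsMonAtom u} → H) f = x := by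
    intro x
    by_cases hx : IsUnit x
    · exact ⟨0, by simp [vectorProd, hred x hx]⟩
    · obtain ⟨l, hl, hlx⟩ := hatomic x hx
      obtain ⟨f, -, hf⟩ := (exists_list_iff_exists_vector x _).1 ⟨l, rfl, hl, hlx⟩
      exact ⟨f, hf⟩
  have : Nonempty {u : H // IsMonAtom u} := by
    by_contra hne
    rw [not_nonempty_iff] at hne
    obtain ⟨f, hf⟩ := hgen a
    exact ha (by rw [← hf]; simp [vectorProd])
  obtain ⟨M, hM⟩ := LengthRel.exists_step hred huc hu hfg hgen
  refine ⟨⟨M + 1, by omega, fun k hk => ?_⟩, ?_⟩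
  · obtain ⟨k, rfl⟩ := Nat.exists_eq_add_of_le' (show 1 ≤ k by omega)
    rw [tsub_le_iff_right, Nat.add_sub_cancel, rhoK, rhoK]
    refine sSup_le ?_
    rintro _ ⟨l, hl, rfl⟩
    rw [unionOfLengths_eq hred] at hl
    obtain ⟨l', hl', h1, -⟩ := hM k l hl
    have h2 : (l' : ℕ∞) ≤ natSetSup (unionOfLengths H k) := by
      rw [unionOfLengths_eq hred]
      exact le_sSup ⟨l', hl', rfl⟩
    calc (l : ℕ∞) ≤ ((M + 1 : ℕ) : ℕ∞) + l' := by exact_mod_cast (by omega)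
      _ ≤ _ := by gcongr
  · unfold SatisfiesStructureThmForUnions
    simp only [unionOfLengths_eq hred]
    exact exists_isAAP_of_rel (LengthRel.refl _) (fun _ _ h => h.symm)
      (fun _ _ _ _ h h' => h.add h') (fun _ h => h.eq_zero hred hu)
      (LengthRel.exists_bound hred huc hu) hM
end

section
/- Let H be a reduced atomic cancellative monoid. Then the monoid of relations ~_H is a saturated submonoid of Z(H) × Z(H), and ~_H is a reduced cancellative BF-monoid. -/
attribute [local instance] Classical.propDecidable

section AdditiveSize

variable {M : Type*} [Monoid M] {size : M → ℕ}

/-- A monoid with an additive size function vanishing only at `1` is reduced. -/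
theorem monReduced_of_size (hmul : ∀ x y, size (x * y) = size x + size y)
    (hzero : ∀ x, size x = 0 → x = 1) : MonReduced M := by
  rintro _ ⟨u, rfl⟩
  have h₁ : size (1 : M) = 0 := by
    have h := hmul 1 1
    rw [one_mul] at h
    omega
  have h₂ := hmul (u : M) (↑u⁻¹ : M)
  rw [Units.mul_inv, h₁] at h₂
  exact hzero _ (by omega)

/-- A monoid with an additive size function vanishing only at `1` is atomic. -/
theorem monAtomic_of_size (hmul : ∀ x y, size (x * y) = size x + size y)
    (hzero : ∀ x, size x = 0 → x = 1) : MonAtomic M := by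
  intro a
  induction hn : size a using Nat.strong_induction_on generalizing a with
  | _ n ih =>
    intro ha
    by_cases hatom : IsMonAtom a
    · exact ⟨[a], by simpa using hatom, by simp⟩
    · simp only [IsMonAtom, not_and, not_forall, not_or] at hatom
      obtain ⟨b, c, rfl, hb, hc⟩ := hatom ha
      have hsize := hmul b c
      have hb₀ : size b ≠ 0 := fun h ↦ hb (hzero b h ▸ isUnit_one)
      have hc₀ : size c ≠ 0 := fun h ↦ hc (hzero c h ▸ isUnit_one)
      obtain ⟨l₁, hl₁, hp₁⟩ := ih _ (by omega) b rfl hb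
      obtain ⟨l₂, hl₂, hp₂⟩ := ih _ (by omega) c rfl hc
      refine ⟨l₁ ++ l₂, fun u hu ↦ ?_, by rw [List.prod_append, hp₁, hp₂]⟩
      exact (List.mem_append.mp hu).elim (hl₁ u) (hl₂ u)

/-- The number of atoms in a product of atoms is at most the size of the product. -/
theorem length_le_size_prod (hmul : ∀ x y, size (x * y) = size x + size y)
    (hzero : ∀ x, size x = 0 → x = 1) (l : List M) (hl : ∀ u ∈ l, IsMonAtom u) :
    l.length ≤ size l.prod := by
  induction l with
  | nil => simp
  | cons a l ih =>
    simp only [List.forall_mem_cons] at hl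
    have ha : size a ≠ 0 := fun h ↦ hl.1.1 (hzero a h ▸ isUnit_one)
    have := ih hl.2
    rw [List.length_cons, List.prod_cons, hmul]
    omega

/-- In a monoid with an additive size function vanishing only at `1`, all sets of lengths
are finite and nonempty. -/
theorem setOfLengths_finite_nonempty_of_size (hmul : ∀ x y, size (x * y) = size x + size y)
    (hzero : ∀ x, size x = 0 → x = 1) (a : M) :
    (setOfLengths a).Finite ∧ (setOfLengths a).Nonempty := by
  unfold setOfLengths
  split_ifs with ha
  · exact ⟨Set.finite_singleton 0, Set.singleton_nonempty 0⟩
  · constructor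
    · refine (Set.finite_Iic (size a)).subset ?_
      rintro _ ⟨l, rfl, hl, rfl⟩
      exact length_le_size_prod hmul hzero l hl
    · obtain ⟨l, hl, hprod⟩ := monAtomic_of_size hmul hzero a
        fun h ↦ ha (monReduced_of_size hmul hzero a h)
      exact ⟨l.length, l, rfl, hl, hprod⟩

end AdditiveSize

/-- The total word length of a relation. -/
def relSize {H : Type*} [Monoid H] (p : relMonoid H) : ℕ :=
  p.1.1.length + p.1.2.length

theorem relSize_mul {H : Type*} [Monoid H] (p q : relMonoid H) :
    relSize (p * q) = relSize p + relSize q := by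
  simp only [relSize, Submonoid.coe_mul, Prod.fst_mul, Prod.snd_mul, FreeMonoid.length_mul]
  omega

theorem eq_one_of_relSize_eq_zero {H : Type*} [Monoid H] (p : relMonoid H)
    (h : relSize p = 0) : p = 1 := by
  obtain ⟨h₁, h₂⟩ := Nat.add_eq_zero_iff.mp h
  exact Subtype.ext (Prod.ext (FreeMonoid.length_eq_zero.mp h₁) (FreeMonoid.length_eq_zero.mp h₂))

/-- Let `H` be a reduced atomic cancellative monoid. Then the
monoid of relations `~_H` is a saturated submonoid of `Z(H) × Z(H)`, and `~_H`
is a reduced cancellative BF-monoid. -/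
theorem statement18 (H : Type*) [Monoid H] (hred : MonReduced H)
    (hatomic : MonAtomic H)
    (hlc : ∀ x y z : H, x * y = x * z → y = z)
    (hrc : ∀ x y z : H, y * x = z * x → y = z) :
    -- `~_H` is saturated in `Z(H) × Z(H)`
    (∀ p q : FacM H × FacM H, q ∈ relMonoid H →
      (p * q ∈ relMonoid H ∨ q * p ∈ relMonoid H) → p ∈ relMonoid H) ∧
    -- `~_H` is reduced and cancellative
    MonReduced (relMonoid H) ∧
    (∀ x y z : relMonoid H, x * y = x * z → y = z) ∧
    (∀ x y z : relMonoid H, y * x = z * x → y = z) ∧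
    -- `~_H` is a BF-monoid: atomic with finite nonempty sets of lengths
    MonAtomic (relMonoid H) ∧
    (∀ a : relMonoid H, (setOfLengths a).Finite ∧ (setOfLengths a).Nonempty) := by
  refine ⟨?_, monReduced_of_size relSize_mul eq_one_of_relSize_eq_zero,
    fun x y z h ↦ mul_left_cancel h, fun x y z h ↦ mul_right_cancel h,
    monAtomic_of_size relSize_mul eq_one_of_relSize_eq_zero,
    setOfLengths_finite_nonempty_of_size relSize_mul eq_one_of_relSize_eq_zero⟩
  rintro ⟨a, b⟩ ⟨c, d⟩ (hq : facProd H c = facProd H d) (h | h)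
  · change facProd H (a * c) = facProd H (b * d) at h
    rw [map_mul, map_mul, hq] at h
    exact hrc _ _ _ h
  · change facProd H (c * a) = facProd H (d * b) at h
    rw [map_mul, map_mul, hq] at h
    exact hlc _ _ _ h
end

section
/- Let H be a reduced atomic cancellative commutative monoid which is finitely generated. Then the monoid of relations ~_H satisfies the ascending chain condition on ideals, and ~_H is finitely generated as a monoid. -/
attribute [local instance] Classical.propDecidable

/-- The factorization monoid of a commutative monoid: the free abelian monoid
(multisets) on the set of atoms, written additively. -/
abbrev FacCM (M : Type*) [CommMonoid M] := Multiset {u : M // IsMonAtom u}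

/-- The product in `M` of a formal factorization. -/
def facCProd {M : Type*} [CommMonoid M] (s : FacCM M) : M :=
  (s.map Subtype.val).prod

/-- The monoid of relations `~_M = {(x, y) ∈ Z(M) × Z(M) : π x = π y}` of a
commutative monoid, as an additive submonoid of `Z(M) × Z(M)` with
`Z(M)` the free abelian monoid on the atoms. -/
def relCMonoid (M : Type*) [CommMonoid M] : AddSubmonoid (FacCM M × FacCM M) where
  carrier := {p | facCProd p.1 = facCProd p.2}
  zero_mem' := rfl
  add_mem' := by
    intro p q hp hq
    simp only [Set.mem_setOf_eq, Prod.fst_add, Prod.snd_add, facCProd,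
      Multiset.map_add, Multiset.prod_add] at *
    rw [hp, hq]

/-- An ideal of an additive commutative monoid `S` is a subset `I` with
`I + S ⊆ I`. -/
def IsAddIdeal {S : Type*} [AddCommMonoid S] (I : Set S) : Prop :=
  ∀ x ∈ I, ∀ s : S, x + s ∈ I

/-- An additive commutative monoid satisfies the ACC on ideals if every
ascending chain of ideals stabilizes. -/
def ACCOnAddIdeals (S : Type*) [AddCommMonoid S] : Prop :=
  ∀ f : ℕ → Set S, (∀ i, IsAddIdeal (f i)) → Monotone f →
    ∃ N : ℕ, ∀ m : ℕ, N ≤ m → f m = f N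

/-- The atoms of a reduced finitely generated commutative monoid form a finite set. -/
theorem finite_isMonAtom {M : Type*} [CommMonoid M] (hred : MonReduced M) (hfg : Monoid.FG M) :
    Finite {u : M // IsMonAtom u} := by
  have : Subsingleton Mˣ :=
    ⟨fun a b => Units.ext ((hred a a.isUnit).trans (hred b b.isUnit).symm)⟩
  have hfin : {p : M | Irreducible p}.Finite := finite_irreducible
  exact (hfin.subset fun u hu => ⟨hu.1, fun _ _ h => hu.2 _ _ h⟩).to_subtype

/-- **Dickson's lemma** for multisets on a finite type. -/
theorem Multiset.wellQuasiOrderedLE_of_finite (α : Type*) [Finite α] :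
    WellQuasiOrderedLE (Multiset α) :=
  Finsupp.orderIsoMultiset.wellQuasiOrderedLE_iff.1 inferInstance

/-- If divisibility in `S` is a well-quasi-order, then `S` satisfies the ACC on ideals. -/
theorem accOnAddIdeals_of_wellQuasiOrdered {S : Type*} [AddCommMonoid S]
    (hS : WellQuasiOrdered fun x y : S => ∃ s, y = x + s) : ACCOnAddIdeals S := by
  intro f hf hmono
  by_contra! h
  choose m hm hne using h
  have hex : ∀ n, ∃ x ∈ f (m n), x ∉ f n := fun n =>
    Set.not_subset.1 fun hsub => hne n (hsub.antisymm (hmono (hm n)))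
  choose x hx hx' using hex
  let a : ℕ → ℕ := fun k => m^[k] 0
  have ha_succ : ∀ k, a (k + 1) = m (a k) := fun k => Function.iterate_succ_apply' m k 0
  have ha : Monotone a := monotone_nat_of_le_succ fun k => ha_succ k ▸ hm (a k)
  obtain ⟨i, j, hij, s, hs⟩ := hS fun k => x (a k)
  refine hx' (a j) ?_
  rw [hs]
  exact hf _ _ (hmono (ha (Nat.succ_le_of_lt hij)) (ha_succ i ▸ hx (a i))) s

/-- In a cancellative commutative monoid, the monoid of relations is closed under
subtraction. -/
theorem mem_relCMonoid_of_add_mem {M : Type*} [CommMonoid M]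
    (hcanc : ∀ x y z : M, x * y = x * z → y = z) {p q : FacCM M × FacCM M}
    (hp : p ∈ relCMonoid M) (hpq : p + q ∈ relCMonoid M) : q ∈ relCMonoid M := by
  change facCProd p.1 = facCProd p.2 at hp
  change facCProd (p.1 + q.1) = facCProd (p.2 + q.2) at hpq
  simp only [facCProd, Multiset.map_add, Multiset.prod_add] at hp hpq
  rw [hp] at hpq
  exact hcanc _ _ _ hpq


/-- Let `H` be a reduced atomic cancellative commutative
finitely generated monoid. Then the monoid of relations `~_H` satisfies the
ascending chain condition on ideals and is finitely generated as a monoid. -/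
theorem statement19 (H : Type*) [CommMonoid H] (hred : MonReduced H)
    (hatomic : MonAtomic H)
    (hcanc : ∀ x y z : H, x * y = x * z → y = z)
    (hfg : Monoid.FG H) :
    ACCOnAddIdeals (relCMonoid H) ∧ (relCMonoid H).FG := by
  have := finite_isMonAtom hred hfg
  have := Multiset.wellQuasiOrderedLE_of_finite {u : H // IsMonAtom u}
  refine ⟨accOnAddIdeals_of_wellQuasiOrdered fun f => ?_, AddSubmonoid.fg_of_subtractive
    fun p hp q hpq => mem_relCMonoid_of_add_mem hcanc hp hpq⟩
  obtain ⟨i, j, hij, hle⟩ := wellQuasiOrdered_le fun n => (f n : FacCM H × FacCM H)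
  obtain ⟨q, hq⟩ := exists_add_of_le hle
  exact ⟨i, j, hij, ⟨q, mem_relCMonoid_of_add_mem hcanc (f i).2 (hq ▸ (f j).2)⟩,
    Subtype.ext hq⟩
end
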